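/- arXiv:0809.1595 — 3 statements merged into one kernel-verified Lean document; each statement's English description precedes it below -/
import Mathlib

section
/- Let R be a commutative ring, M an (FP)_∞ R-module of finite projective dimension. Then the restricted Gorenstein dimension of M equals the projective dimension of M. -/
open CategoryTheory Opposite TensorProduct

universe u

namespace AB

/-- `M` is `(FP)ₙ`: there is an exact sequence `Fₙ → ⋯ → F₀ → M → 0`
with each `Fᵢ` finitely generated free.  Equivalently (the form used here),
`(FP)₀` means finitely generated, and `M` is `(FP)_{n+1}` iff there is a
surjection from a finitely generated free module whose kernel is `(FP)ₙ`. -/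
def IsFP (R : Type u) [CommRing R] : ℕ → ModuleCat.{u} R → Prop
  | 0, M => Module.Finite R M
  | n + 1, M => ∃ (k : ℕ) (f : (Fin k → R) →ₗ[R] M), Function.Surjective f ∧
      IsFP R n (ModuleCat.of R (LinearMap.ker f))

/-- `M` is `(FP)_∞`. -/
def IsFPInf (R : Type u) [CommRing R] (M : ModuleCat.{u} R) : Prop := ∀ n, IsFP R n M

/-- `Ext^i_R(M, N)` as a type. -/
noncomputable abbrev ext (R : Type u) [CommRing R] (M N : ModuleCat.{u} R) (i : ℕ) :=
  ((Ext R (ModuleCat.{u} R) i).obj (op M)).obj N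

/-- `Ext^i_R(M, N) = 0`. -/
def extZero (R : Type u) [CommRing R] (M N : ModuleCat.{u} R) (i : ℕ) : Prop :=
  Subsingleton (ext R M N i)

/-- membership in the G-class `G(R)`. -/
def MemG (R : Type u) [CommRing R] (M : ModuleCat.{u} R) : Prop :=
  Module.Finite R M ∧ Module.IsReflexive R M ∧
    (∀ i > 0, extZero R M (ModuleCat.of R R) i) ∧
    (∀ i > 0, extZero R (ModuleCat.of R (Module.Dual R M)) (ModuleCat.of R R) i)

/-- membership in the restricted G-class `G̃(R)`. -/
def MemGtilde (R : Type u) [CommRing R] (M : ModuleCat.{u} R) : Prop :=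
  MemG R M ∧ IsFPInf R M ∧ IsFPInf R (ModuleCat.of R (Module.Dual R M))

/-- `Gdim_R M ≤ n`. -/
def GDimLe (R : Type u) [CommRing R] : ℕ → ModuleCat.{u} R → Prop
  | 0, M => MemG R M
  | n + 1, M => ∃ (G : ModuleCat.{u} R) (f : G →ₗ[R] M), MemG R G ∧ Function.Surjective f ∧
      GDimLe R n (ModuleCat.of R (LinearMap.ker f))

/-- `G̃dim_R M ≤ n`. -/
def GtildeDimLe (R : Type u) [CommRing R] : ℕ → ModuleCat.{u} R → Prop
  | 0, M => MemGtilde R M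
  | n + 1, M => ∃ (G : ModuleCat.{u} R) (f : G →ₗ[R] M), MemGtilde R G ∧ Function.Surjective f ∧
      GtildeDimLe R n (ModuleCat.of R (LinearMap.ker f))

/-- `pd_R M ≤ n`. -/
def ProjDimLe (R : Type u) [CommRing R] : ℕ → ModuleCat.{u} R → Prop
  | 0, M => Module.Projective R M
  | n + 1, M => ∃ (P : ModuleCat.{u} R) (f : P →ₗ[R] M), Module.Projective R P ∧
      Function.Surjective f ∧ ProjDimLe R n (ModuleCat.of R (LinearMap.ker f))

/-- The G-dimension of `M`, as an element of `ℕ∞` (`⊤` meaning `Gdim` is infinite/undefined). -/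
noncomputable def GDim (R : Type u) [CommRing R] (M : ModuleCat.{u} R) : ℕ∞ :=
  sInf {n : ℕ∞ | ∃ m : ℕ, n = m ∧ GDimLe R m M}

/-- The restricted G-dimension of `M`, as an element of `ℕ∞`. -/
noncomputable def GtildeDim (R : Type u) [CommRing R] (M : ModuleCat.{u} R) : ℕ∞ :=
  sInf {n : ℕ∞ | ∃ m : ℕ, n = m ∧ GtildeDimLe R m M}

/-- The projective dimension of `M`, as an element of `ℕ∞`. -/
noncomputable def ProjDim (R : Type u) [CommRing R] (M : ModuleCat.{u} R) : ℕ∞ :=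
  sInf {n : ℕ∞ | ∃ m : ℕ, n = m ∧ ProjDimLe R m M}

/-- The classical depth of `N` with respect to the ideal `I`: the supremum of the
lengths of regular sequences on `N` contained in `I`. -/
noncomputable def cdepth (S : Type u) [CommRing S] (I : Ideal S) (N : Type u)
    [AddCommGroup N] [Module S N] : ℕ∞ :=
  ⨆ rs : {l : List S // (∀ r ∈ l, r ∈ I) ∧ RingTheory.Sequence.IsRegular N l},
    (rs.1.length : ℕ∞)

/-- A bundled faithfully flat (commutative) algebra extension of `R`. -/
structure FFExt (R : Type u) [CommRing R] where
  S : Type u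
  [ring : CommRing S]
  [alg : Algebra R S]
  faithfullyFlat : Module.FaithfullyFlat R S

attribute [instance] FFExt.ring FFExt.alg

/-- The depth of a module `M` over a quasi-local ring `R`: the supremum, over all
faithfully flat extensions `S` of `R`, of the classical depth of `M ⊗_R S` with
respect to `mS`. -/
noncomputable def depth (R : Type u) [CommRing R] [IsLocalRing R] (M : Type u)
    [AddCommGroup M] [Module R M] : ℕ∞ :=
  ⨆ E : FFExt R,
    cdepth E.S (Ideal.map (algebraMap R E.S) (IsLocalRing.maximalIdeal R))
      (TensorProduct R E.S M)

end AB

namespace AB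

variable {R : Type u} [CommRing R]

section FP

variable {A B : Type u} [AddCommGroup A] [Module R A] [AddCommGroup B] [Module R B]

theorem IsFP.of_equiv {n : ℕ} (e : A ≃ₗ[R] B) (h : IsFP R n (ModuleCat.of R A)) :
    IsFP R n (ModuleCat.of R B) := by
  induction n generalizing A B with
  | zero =>
    have : Module.Finite R A := h
    exact Module.Finite.equiv e
  | succ n ih =>
    obtain ⟨k, f, hf, hk⟩ := h
    exact ⟨k, e.toLinearMap ∘ₗ f, e.surjective.comp hf,
      ih (LinearEquiv.ofEq _ _ (LinearEquiv.ker_comp e f).symm) hk⟩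

theorem IsFP.prod_free {n : ℕ} (k : ℕ) (h : IsFP R n (ModuleCat.of R A)) :
    IsFP R n (ModuleCat.of R (A × (Fin k → R))) := by
  cases n with
  | zero =>
    have : Module.Finite R A := h
    exact inferInstanceAs (Module.Finite R (A × (Fin k → R)))
  | succ n =>
    obtain ⟨l, f, hf, hk⟩ := h
    let e : (Fin (l + k) → R) ≃ₗ[R] (Fin l → R) × (Fin k → R) :=
      LinearEquiv.funCongrLeft R R finSumFinEquiv ≪≫ₗ
        LinearEquiv.sumArrowLequivProdArrow (Fin l) (Fin k) R R
    let g : (Fin (l + k) → R) →ₗ[R] A × (Fin k → R) :=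
      (f.prodMap LinearMap.id) ∘ₗ e.toLinearMap
    let i : (Fin l → R) →ₗ[R] (Fin (l + k) → R) := e.symm.toLinearMap ∘ₗ LinearMap.inl R _ _
    have hgi (x) : g (i x) = (f x, 0) := by simp [g, i]
    have hi : Function.Injective i := e.symm.injective.comp LinearMap.inl_injective
    let j : LinearMap.ker f →ₗ[R] LinearMap.ker g :=
      i.restrict fun x hx => by
        rw [LinearMap.mem_ker] at hx ⊢
        rw [hgi, hx]; rfl
    refine ⟨l + k, g, (hf.prodMap Function.surjective_id).comp e.surjective,
      hk.of_equiv (LinearEquiv.ofBijective j ⟨fun x y hxy => ?_, fun y => ?_⟩)⟩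
    · exact Subtype.ext (hi congr(($hxy).1))
    · have hy : (f (e y).1, (e y).2) = (0 : A × (Fin k → R)) := y.2
      rw [Prod.mk_eq_zero] at hy
      refine ⟨⟨(e y).1, hy.1⟩, Subtype.ext (e.injective ?_)⟩
      exact (e.apply_symm_apply _).trans (Prod.ext rfl hy.2.symm)

theorem nonempty_equiv_ker_prod_of_surjective {P : Type*} [AddCommGroup P] [Module R P]
    [Module.Projective R P] (f : A →ₗ[R] P) (hf : Function.Surjective f) :
    Nonempty (A ≃ₗ[R] LinearMap.ker f × P) := by
  have hex : Function.Exact (LinearMap.ker f).subtype f := LinearMap.exact_subtype_ker_map f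
  obtain ⟨s, hs⟩ := Module.projective_lifting_property f LinearMap.id hf
  exact ⟨(hex.splitSurjectiveEquiv (Submodule.subtype_injective _) ⟨s, hs⟩).1⟩

theorem IsFP.of_prod_free {n : ℕ} (k : ℕ) (h : IsFP R n (ModuleCat.of R (A × (Fin k → R)))) :
    IsFP R n (ModuleCat.of R A) := by
  cases n with
  | zero =>
    have : Module.Finite R (A × (Fin k → R)) := h
    exact Module.Finite.of_surjective (LinearMap.fst R A (Fin k → R)) Prod.fst_surjective
  | succ n =>
    obtain ⟨l, f, hf, hk⟩ := h
    let g : (Fin l → R) →ₗ[R] A := LinearMap.fst R _ _ ∘ₗ f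
    let p : LinearMap.ker g →ₗ[R] (Fin k → R) :=
      LinearMap.snd R _ _ ∘ₗ f ∘ₗ (LinearMap.ker g).subtype
    have hp : Function.Surjective p := fun y => by
      obtain ⟨x, hx⟩ := hf (0, y)
      exact ⟨⟨x, congr(($hx).1)⟩, congr(($hx).2)⟩
    obtain ⟨e⟩ := nonempty_equiv_ker_prod_of_surjective p hp
    let j : LinearMap.ker f →ₗ[R] LinearMap.ker p :=
      (Submodule.inclusion (LinearMap.ker_le_ker_comp f _)).codRestrict _ fun x => by
        have hx : f x = 0 := x.2
        simp [p, hx]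
    have hj : Function.Bijective j :=
      ⟨fun x y hxy => Subtype.ext congr(($hxy).1.1), fun y =>
        ⟨⟨y.1.1, Prod.ext y.1.2 y.2⟩, rfl⟩⟩
    have hp' : IsFP R n (ModuleCat.of R (LinearMap.ker p)) :=
      hk.of_equiv (LinearEquiv.ofBijective j hj)
    exact ⟨l, g, Prod.fst_surjective.comp hf, (hp'.prod_free k).of_equiv e.symm⟩

theorem isFP_ker_iff {n k : ℕ} (f : A →ₗ[R] (Fin k → R)) (hf : Function.Surjective f) :
    IsFP R n (ModuleCat.of R (LinearMap.ker f)) ↔ IsFP R n (ModuleCat.of R A) := by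
  obtain ⟨e⟩ := nonempty_equiv_ker_prod_of_surjective f hf
  exact ⟨fun h => (h.prod_free k).of_equiv e.symm, fun h => (h.of_equiv e).of_prod_free k⟩

/-- If `A` is `(FP)_{n+1}`, then the kernel of any surjection onto `A` from a finitely generated
free module is `(FP)ₙ`. -/
theorem IsFP.ker {n k : ℕ} (h : IsFP R (n + 1) (ModuleCat.of R A)) (g : (Fin k → R) →ₗ[R] A)
    (hg : Function.Surjective g) : IsFP R n (ModuleCat.of R (LinearMap.ker g)) := by
  obtain ⟨l, f, hf, hk⟩ := h
  let E := LinearMap.ker (f ∘ₗ LinearMap.fst R _ _ - g ∘ₗ LinearMap.snd R (Fin l → R) (Fin k → R))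
  have hE (x : E) : f x.1.1 = g x.1.2 := sub_eq_zero.mp x.2
  let p : E →ₗ[R] (Fin l → R) := LinearMap.fst R _ _ ∘ₗ E.subtype
  let q : E →ₗ[R] (Fin k → R) := LinearMap.snd R _ _ ∘ₗ E.subtype
  have hp : Function.Surjective p := fun a => by
    obtain ⟨b, hb⟩ := hg (f a)
    exact ⟨⟨(a, b), sub_eq_zero.mpr hb.symm⟩, rfl⟩
  have hq : Function.Surjective q := fun b => by
    obtain ⟨a, ha⟩ := hf (g b)
    exact ⟨⟨(a, b), sub_eq_zero.mpr ha⟩, rfl⟩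
  let i : LinearMap.ker f →ₗ[R] LinearMap.ker q :=
    ((LinearMap.inl R _ _ ∘ₗ (LinearMap.ker f).subtype).codRestrict E fun x =>
      sub_eq_zero.mpr (by simp)).codRestrict _ fun x => rfl
  let j : LinearMap.ker g →ₗ[R] LinearMap.ker p :=
    ((LinearMap.inr R _ _ ∘ₗ (LinearMap.ker g).subtype).codRestrict E fun x =>
      sub_eq_zero.mpr (by simp)).codRestrict _ fun x => rfl
  have hi : Function.Bijective i := ⟨fun x y hxy => Subtype.ext congr(($hxy).1.1.1), fun y => by
    have hy : y.1.1.2 = 0 := y.2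
    refine ⟨⟨y.1.1.1, (hE y.1).trans (by rw [hy, map_zero])⟩, ?_⟩
    exact Subtype.ext (Subtype.ext (Prod.ext rfl hy.symm))⟩
  have hj : Function.Bijective j := ⟨fun x y hxy => Subtype.ext congr(($hxy).1.1.2), fun y => by
    have hy : y.1.1.1 = 0 := y.2
    refine ⟨⟨y.1.1.2, (hE y.1).symm.trans (by rw [hy, map_zero])⟩, ?_⟩
    exact Subtype.ext (Subtype.ext (Prod.ext hy.symm rfl))⟩
  have h1 := (isFP_ker_iff q hq).mp (hk.of_equiv (LinearEquiv.ofBijective i hi))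
  exact ((isFP_ker_iff p hp).mpr h1).of_equiv (LinearEquiv.ofBijective j hj).symm

theorem IsFPInf.ker {k : ℕ} (h : IsFPInf R (ModuleCat.of R A)) (g : (Fin k → R) →ₗ[R] A)
    (hg : Function.Surjective g) : IsFPInf R (ModuleCat.of R (LinearMap.ker g)) :=
  fun n => (h (n + 1)).ker g hg

theorem isFPInf_of_projective [Module.Finite R A] [Module.Projective R A] :
    IsFPInf R (ModuleCat.of R A) := by
  intro n
  induction n generalizing A with
  | zero => exact ‹Module.Finite R A›
  | succ n ih =>
    obtain ⟨k, f, hf⟩ := Module.Finite.exists_fin' R A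
    obtain ⟨e⟩ := nonempty_equiv_ker_prod_of_surjective f hf
    have : Module.Projective R (LinearMap.ker f) :=
      .of_split (e.symm.toLinearMap ∘ₗ LinearMap.inl R _ _) (LinearMap.fst R _ _ ∘ₗ e.toLinearMap)
        (by ext; simp)
    have : Module.Finite R (LinearMap.ker f) :=
      Module.Finite.of_surjective (LinearMap.fst R _ _ ∘ₗ e.toLinearMap)
        (Prod.fst_surjective.comp e.surjective)
    exact ⟨k, f, hf, ih⟩

end FP

theorem extZero_of_projective (M N : ModuleCat.{u} R) [Module.Projective R M] {i : ℕ}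
    (hi : 0 < i) : extZero R M N i := by
  obtain ⟨i, rfl⟩ := Nat.exists_eq_succ_of_ne_zero hi.ne'
  exact ModuleCat.subsingleton_of_isZero (isZero_Ext_succ_of_projective (R := R) M N i)

theorem memGtilde_of_projective (M : ModuleCat.{u} R) [Module.Finite R M]
    [Module.Projective R M] : MemGtilde R M :=
  ⟨⟨inferInstance, inferInstance, fun _ hi => extZero_of_projective M _ hi,
    fun _ hi => extZero_of_projective _ _ hi⟩, isFPInf_of_projective, isFPInf_of_projective⟩

theorem subsingleton_ext_of_extZero {M N : ModuleCat.{u} R} {i : ℕ} (hi : 0 < i)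
    (h : extZero R M N i) : Subsingleton (Abelian.Ext.{u} M N i) := by
  obtain ⟨i, rfl⟩ := Nat.exists_eq_succ_of_ne_zero hi.ne'
  let P := projectiveResolution M
  have h0 : Limits.IsZero ((P.complex.linearYonedaObj R N).homology (i + 1)) :=
    (ModuleCat.isZero_iff_subsingleton.mpr h).of_iso (P.isoExt (i + 1) N).symm
  rw [← HomologicalComplex.exactAt_iff_isZero_homology,
    HomologicalComplex.exactAt_iff' _ i (i + 1) (i + 2) (by simp) (by simp),
    ShortComplex.moduleCat_exact_iff] at h0
  refine subsingleton_of_forall_eq 0 fun x => ?_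
  obtain ⟨f, hf, rfl⟩ := P.extMk_surjective x (i + 2) rfl
  rw [P.extMk_eq_zero_iff f _ rfl hf i rfl]
  exact h0 f hf

section dim

open CategoryTheory.Abelian

variable {M N : ModuleCat.{u} R}

theorem subsingleton_ext_of_gtildeDimLe {m : ℕ} (h : GtildeDimLe R m M) {i : ℕ} (hi : m < i) :
    Subsingleton (Ext.{u} M (ModuleCat.of R R) i) := by
  induction m generalizing M i with
  | zero => exact subsingleton_ext_of_extZero hi (h.1.2.2.1 i hi)
  | succ m ih =>
    obtain ⟨G, f, hG, hf, hK⟩ := h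
    obtain ⟨i, rfl⟩ := Nat.exists_eq_add_of_lt (Nat.zero_lt_of_lt hi)
    have hS := LinearMap.shortExact_shortComplexKer hf
    have h1 := subsingleton_ext_of_extZero (i := 0 + i + 1) (by lia) (hG.1.2.2.1 _ (by lia))
    have h2 := ih hK (i := i) (by lia)
    refine subsingleton_of_forall_eq 0 fun x => ?_
    obtain ⟨y, rfl⟩ := Ext.contravariant_sequence_exact₃ hS _ x (h1.elim _ _)
      (n₀ := i) (by lia)
    rw [h2.elim y 0, Ext.comp_zero]

theorem subsingleton_ext_ker {P : ModuleCat.{u} R} [Module.Projective R P] (f : P →ₗ[R] M)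
    (hf : Function.Surjective f) {i : ℕ} (hi : 0 < i) (h : Subsingleton (Ext.{u} M N (i + 1))) :
    Subsingleton (Ext.{u} (ModuleCat.of R (LinearMap.ker f)) N i) := by
  have hS := LinearMap.shortExact_shortComplexKer hf
  refine subsingleton_of_forall_eq 0 fun x => ?_
  obtain ⟨y, rfl⟩ := Ext.contravariant_sequence_exact₁ hS _ x (add_comm 1 i) (h.elim _ _)
  have := HasProjectiveDimensionLT.subsingleton P 1 i hi N
  rw [Subsingleton.elim y 0, Ext.comp_zero]

theorem exists_extend_of_subsingleton_ext {P : ModuleCat.{u} R} (f : P →ₗ[R] M)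
    (hf : Function.Surjective f) (h : Subsingleton (Ext.{u} M N 1)) (φ : LinearMap.ker f →ₗ[R] N) :
    ∃ ψ : P →ₗ[R] N, ψ ∘ₗ (LinearMap.ker f).subtype = φ := by
  have hS := LinearMap.shortExact_shortComplexKer hf
  obtain ⟨y, hy⟩ := Ext.contravariant_sequence_exact₁ hS N (Ext.mk₀ (ModuleCat.ofHom φ))
    (add_zero 1) (h.elim _ _)
  obtain ⟨ψ, rfl⟩ := (Ext.mk₀_bijective _ _).2 y
  rw [Ext.mk₀_comp_mk₀] at hy
  exact ⟨ψ.hom, congr(($((Ext.mk₀_bijective _ _).1 hy)).hom)⟩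

/-- If the kernel `K` of a surjection from a projective module onto `M` is finitely generated
projective and `Ext¹(M, R) = 0`, then `M` is projective. -/
theorem projective_of_subsingleton_ext_one {P : ModuleCat.{u} R} [Module.Projective R P]
    (f : P →ₗ[R] M) (hf : Function.Surjective f) [Module.Finite R (LinearMap.ker f)]
    [Module.Projective R (LinearMap.ker f)]
    (h : Subsingleton (Ext.{u} M (ModuleCat.of R R) 1)) : Module.Projective R M := by
  obtain ⟨n, p, s, -, -, hps⟩ :=
    Module.Finite.exists_comp_eq_id_of_projective R (LinearMap.ker f)
  choose ψ hψ using fun j =>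
    exists_extend_of_subsingleton_ext f hf h (LinearMap.proj j ∘ₗ s)
  let r : P →ₗ[R] LinearMap.ker f := p ∘ₗ LinearMap.pi ψ
  have hr : r ∘ₗ (LinearMap.ker f).subtype = LinearMap.id := by
    rw [← hps, LinearMap.comp_assoc]
    congr 1
    ext x j
    exact congr($(hψ j) x)
  have hex : Function.Exact (LinearMap.ker f).subtype f := LinearMap.exact_subtype_ker_map f
  let e := hex.splitInjectiveEquiv hf ⟨r, hr⟩
  exact .of_split (e.1.symm.toLinearMap ∘ₗ LinearMap.inr R _ _)
    (LinearMap.snd R _ _ ∘ₗ e.1.toLinearMap) (by ext; simp)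

theorem projDimLe_iff {n : ℕ} : ProjDimLe R n M ↔ HasProjectiveDimensionLE M n := by
  induction n generalizing M with
  | zero =>
    rw [← projective_iff_hasProjectiveDimensionLE_zero]
    exact IsProjective.iff_projective M
  | succ n ih =>
    constructor
    · rintro ⟨P, f, hP, hf, hK⟩
      exact ((LinearMap.shortExact_shortComplexKer hf).hasProjectiveDimensionLT_X₃_iff n
        inferInstance).mpr (ih.mp hK)
    · intro h
      let f : (M →₀ R) →ₗ[R] M := Finsupp.linearCombination R id
      have hf : Function.Surjective f := Finsupp.linearCombination_id_surjective R M
      exact ⟨ModuleCat.of R (M →₀ R), f, inferInstanceAs (Module.Projective R (M →₀ R)), hf,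
        ih.mpr (((LinearMap.shortExact_shortComplexKer
          (M := ModuleCat.of R (M →₀ R)) hf).hasProjectiveDimensionLT_X₃_iff n
          (ModuleCat.projective_of_categoryTheory_projective _)).mp h)⟩

/-- A finite free cover of an `(FP)_∞` module, whose kernel is `(FP)_∞` and controls the projective
dimension. -/
theorem IsFPInf.exists_cover (h : IsFPInf R M) :
    ∃ (k : ℕ) (f : (Fin k → R) →ₗ[R] M), Function.Surjective f ∧
      IsFPInf R (ModuleCat.of R (LinearMap.ker f)) ∧
      ∀ n, ProjDimLe R (n + 1) M ↔ ProjDimLe R n (ModuleCat.of R (LinearMap.ker f)) := by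
  have : Module.Finite R M := h 0
  obtain ⟨k, f, hf⟩ := Module.Finite.exists_fin' R M
  refine ⟨k, f, hf, IsFPInf.ker h f hf, fun n => ?_⟩
  rw [projDimLe_iff, projDimLe_iff]
  exact (LinearMap.shortExact_shortComplexKer
    (M := ModuleCat.of R (Fin k → R)) hf).hasProjectiveDimensionLT_X₃_iff n
      (ModuleCat.projective_of_categoryTheory_projective _)

theorem gtildeDimLe_of_projDimLe {n : ℕ} (hM : IsFPInf R M) (h : ProjDimLe R n M) :
    GtildeDimLe R n M := by
  induction n generalizing M with
  | zero =>
    have : Module.Finite R M := hM 0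
    have : Module.Projective R M := h
    exact memGtilde_of_projective M
  | succ n ih =>
    obtain ⟨k, f, hf, hK, hn⟩ := hM.exists_cover
    exact ⟨ModuleCat.of R (Fin k → R), f, memGtilde_of_projective _, hf, ih hK ((hn n).mp h)⟩

theorem projective_of_subsingleton_ext {n : ℕ} (hM : IsFPInf R M) (h : ProjDimLe R n M)
    (hE : ∀ i > 0, Subsingleton (Ext.{u} M (ModuleCat.of R R) i)) : Module.Projective R M := by
  induction n generalizing M with
  | zero => exact h
  | succ n ih =>
    obtain ⟨k, f, hf, hK, hn⟩ := hM.exists_cover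
    have : Module.Finite R (LinearMap.ker f) := hK 0
    have : Module.Projective R (LinearMap.ker f) := ih hK ((hn n).mp h) fun i hi =>
      subsingleton_ext_ker (P := ModuleCat.of R (Fin k → R)) f hf hi (hE _ (by lia))
    exact projective_of_subsingleton_ext_one (P := ModuleCat.of R (Fin k → R)) f hf
      (hE 1 one_pos)

theorem projDimLe_of_subsingleton_ext {n m : ℕ} (hM : IsFPInf R M) (h : ProjDimLe R n M)
    (hE : ∀ i > m, Subsingleton (Ext.{u} M (ModuleCat.of R R) i)) : ProjDimLe R m M := by
  induction m generalizing M n with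
  | zero => exact projective_of_subsingleton_ext hM h hE
  | succ m ih =>
    obtain ⟨k, f, hf, hK, hn⟩ := hM.exists_cover
    have h' : ProjDimLe R (n + 1) M := by
      rw [projDimLe_iff] at h ⊢
      exact hasProjectiveDimensionLT_of_ge M (n + 1) _ (by lia)
    exact (hn m).mpr <| ih hK ((hn n).mp h') fun i hi =>
      subsingleton_ext_ker (P := ModuleCat.of R (Fin k → R)) f hf (by lia) (hE _ (by lia))

end dim

end AB

theorem gtildeDim_eq_projDim (R : Type u) [CommRing R] (M : ModuleCat.{u} R)
    (hfp : AB.IsFPInf R M) (hpd : AB.ProjDim R M ≠ ⊤) :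
    AB.GtildeDim R M = AB.ProjDim R M := by
  obtain ⟨_, n, rfl, hn⟩ : {n : ℕ∞ | ∃ m : ℕ, n = m ∧ AB.ProjDimLe R m M}.Nonempty := by
    by_contra hempty
    rw [Set.not_nonempty_iff_eq_empty] at hempty
    exact hpd (by rw [AB.ProjDim, hempty, sInf_empty])
  have key (m : ℕ) : AB.GtildeDimLe R m M ↔ AB.ProjDimLe R m M :=
    ⟨fun h => AB.projDimLe_of_subsingleton_ext hfp hn fun _ hi =>
      AB.subsingleton_ext_of_gtildeDimLe h hi, AB.gtildeDimLe_of_projDimLe hfp⟩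
  simp only [AB.GtildeDim, AB.ProjDim, key]
end

section
/- Let M be a nonzero (FP)_∞ R-module of finite restricted G-dimension. Then G̃dim_R M = sup{ i ≥ 0 : Ext^i_R(M,R) ≠ 0 }. -/
open CategoryTheory Opposite TensorProduct

universe u

namespace AB

section FP

variable {R : Type u} [CommRing R]

theorem IsFP.of_linearEquiv {n : ℕ} {M N : Type u} [AddCommGroup M] [Module R M]
    [AddCommGroup N] [Module R N] (e : M ≃ₗ[R] N) (h : IsFP R n (ModuleCat.of R M)) :
    IsFP R n (ModuleCat.of R N) := by
  cases n with
  | zero =>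
    have : Module.Finite R M := h
    exact Module.Finite.equiv e
  | succ n =>
    obtain ⟨k, f, hf, hk⟩ := h
    refine ⟨k, e.toLinearMap ∘ₗ f, e.surjective.comp hf, ?_⟩
    rwa [show LinearMap.ker (e.toLinearMap ∘ₗ f) = LinearMap.ker f from LinearEquiv.ker_comp e f]

theorem IsFP.of_surjective_free {n : ℕ} {F M : Type u} [AddCommGroup F] [Module R F]
    [Module.Finite R F] [Module.Free R F] [AddCommGroup M] [Module R M] (f : F →ₗ[R] M)
    (hf : Function.Surjective f) (hk : IsFP R n (ModuleCat.of R (LinearMap.ker f))) :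
    IsFP R (n + 1) (ModuleCat.of R M) := by
  let b := Module.Free.chooseBasis R F
  let e : F ≃ₗ[R] (Fin (Fintype.card (Module.Free.ChooseBasisIndex R F)) → R) :=
    (b.reindex (Fintype.equivFin _)).equivFun
  refine ⟨_, f ∘ₗ e.symm.toLinearMap, hf.comp e.symm.surjective, ?_⟩
  refine IsFP.of_linearEquiv (M := LinearMap.ker f) (e.ofSubmodules _ _ ?_) hk
  ext x
  simp [Submodule.mem_map_equiv]

theorem IsFP.of_subsingleton (n : ℕ) (M : Type u) [AddCommGroup M] [Module R M]
    [Subsingleton M] : IsFP R n (ModuleCat.of R M) := by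
  induction n generalizing M with
  | zero => exact (inferInstance : Module.Finite R M)
  | succ n ih => exact ⟨0, 0, fun x => ⟨0, Subsingleton.elim _ _⟩, ih _⟩

theorem IsFP.of_free (n : ℕ) (F : Type u) [AddCommGroup F] [Module R F] [Module.Finite R F]
    [Module.Free R F] : IsFP R n (ModuleCat.of R F) := by
  cases n with
  | zero => exact (inferInstance : Module.Finite R F)
  | succ n =>
    refine IsFP.of_surjective_free (LinearMap.id : F →ₗ[R] F) Function.surjective_id ?_
    have : Subsingleton (LinearMap.ker (LinearMap.id : F →ₗ[R] F)) := by
      rw [LinearMap.ker_id]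
      infer_instance
    exact IsFP.of_subsingleton n _

variable {A B C : Type u} [AddCommGroup A] [Module R A] [AddCommGroup B] [Module R B]
  [AddCommGroup C] [Module R C] {i : A →ₗ[R] B} {p : B →ₗ[R] C}

theorem IsFP.of_extension {n : ℕ} (hi : Function.Injective i) (hip : Function.Exact i p)
    (hp : Function.Surjective p) (hA : IsFP R n (ModuleCat.of R A))
    (hC : IsFP R n (ModuleCat.of R C)) : IsFP R n (ModuleCat.of R B) := by
  induction n generalizing A B C with
  | zero =>
    have : Module.Finite R A := hA
    have : Module.Finite R C := hC
    have : Module.Finite R (LinearMap.ker p) := by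
      rw [hip.linearMap_ker_eq]
      infer_instance
    have : Module.Finite R (B ⧸ LinearMap.ker p) :=
      Module.Finite.equiv (p.quotKerEquivOfSurjective hp).symm
    exact Module.Finite.of_submodule_quotient (LinearMap.ker p)
  | succ n ih =>
    obtain ⟨a, f, hf, hfk⟩ := hA
    obtain ⟨c, g, hg, hgk⟩ := hC
    change (Fin a → R) →ₗ[R] A at f
    change (Fin c → R) →ₗ[R] C at g
    obtain ⟨s, hs⟩ := Module.projective_lifting_property p g hp
    have hs' : ∀ y, p (s y) = g y := fun y => LinearMap.congr_fun hs y
    have hpi : ∀ x, p (i x) = 0 := hip.apply_apply_eq_zero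
    let h : ((Fin a → R) × (Fin c → R)) →ₗ[R] B := (i ∘ₗ f).coprod s
    have hh : ∀ x y, h (x, y) = i (f x) + s y := fun x y => rfl
    have hl : ∀ x ∈ LinearMap.ker f,
        LinearMap.inl R (Fin a → R) (Fin c → R) x ∈ LinearMap.ker h := by
      intro x hx
      simp only [LinearMap.mem_ker] at hx ⊢
      simp [hh, hx]
    have hr : ∀ x ∈ LinearMap.ker h,
        LinearMap.snd R (Fin a → R) (Fin c → R) x ∈ LinearMap.ker g := by
      rintro ⟨x, y⟩ hx
      simp only [LinearMap.mem_ker, hh] at hx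
      have := congrArg p hx
      simpa [hpi, hs'] using this
    refine IsFP.of_surjective_free h ?_ (ih (i := (LinearMap.inl R _ _).restrict hl)
      (p := (LinearMap.snd R _ _).restrict hr) ?_ ?_ ?_ hfk hgk)
    · intro b
      obtain ⟨y, hy⟩ := hg (p b)
      obtain ⟨z, hz⟩ := (hip (b - s y)).1 (by rw [map_sub, hs', hy, sub_self])
      obtain ⟨x, rfl⟩ := hf z
      exact ⟨(x, y), by rw [hh, hz, sub_add_cancel]⟩
    · rintro ⟨x, hx⟩ ⟨y, hy⟩ hxy
      simpa [Subtype.ext_iff] using hxy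
    · rintro ⟨⟨x, y⟩, hxy⟩
      constructor
      · intro h0
        have h0 : y = 0 := congrArg Subtype.val h0
        subst h0
        simp only [LinearMap.mem_ker, hh, map_zero, add_zero] at hxy
        exact ⟨⟨x, hi (by rw [hxy, map_zero])⟩, rfl⟩
      · rintro ⟨z, hz⟩
        have := congrArg (fun t => t.1.2) hz
        exact Subtype.ext this.symm
    · rintro ⟨y, hy⟩
      rw [LinearMap.mem_ker] at hy
      obtain ⟨z, hz⟩ := (hip (s y)).1 (by rw [hs', hy])
      obtain ⟨x, rfl⟩ := hf z
      exact ⟨⟨(-x, y), by simp [hh, hz]⟩, rfl⟩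

theorem IsFP.of_quotient {n : ℕ} (hi : Function.Injective i) (hip : Function.Exact i p)
    (hp : Function.Surjective p) (hA : IsFP R n (ModuleCat.of R A))
    (hB : IsFP R (n + 1) (ModuleCat.of R B)) : IsFP R (n + 1) (ModuleCat.of R C) := by
  obtain ⟨k, f, hf, hfk⟩ := hB
  change (Fin k → R) →ₗ[R] B at f
  refine ⟨k, p ∘ₗ f, hp.comp hf, ?_⟩
  have hle : LinearMap.ker f ≤ LinearMap.ker (p ∘ₗ f) := LinearMap.ker_le_ker_comp f p
  let e : A ≃ₗ[R] LinearMap.ker p :=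
    (LinearEquiv.ofInjective i hi).trans (LinearEquiv.ofEq _ _ hip.linearMap_ker_eq.symm)
  have he : IsFP R n (ModuleCat.of R (LinearMap.ker p)) := IsFP.of_linearEquiv e hA
  refine IsFP.of_extension (i := Submodule.inclusion hle)
    (p := f.restrict (p := LinearMap.ker (p ∘ₗ f)) (q := LinearMap.ker p) fun x hx => hx)
    (Submodule.inclusion_injective hle) ?_ ?_ hfk he
  · rintro ⟨x, hx⟩
    constructor
    · intro h0
      exact ⟨⟨x, congrArg Subtype.val h0⟩, rfl⟩
    · rintro ⟨z, hz⟩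
      obtain rfl : z.1 = x := congrArg Subtype.val hz
      exact Subtype.ext z.2
  · rintro ⟨y, hy⟩
    obtain ⟨x, rfl⟩ := hf y
    exact ⟨⟨x, hy⟩, rfl⟩

theorem IsFP.of_kernel {n : ℕ} (hi : Function.Injective i) (hip : Function.Exact i p)
    (hp : Function.Surjective p) (hB : IsFP R n (ModuleCat.of R B))
    (hC : IsFP R (n + 1) (ModuleCat.of R C)) : IsFP R n (ModuleCat.of R A) := by
  obtain ⟨c, g, hg, hgk⟩ := hC
  change (Fin c → R) →ₗ[R] C at g
  obtain ⟨s, hs⟩ := Module.projective_lifting_property p g hp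
  have hs' : ∀ y, p (s y) = g y := fun y => LinearMap.congr_fun hs y
  have hpi : ∀ x, p (i x) = 0 := hip.apply_apply_eq_zero
  let h : (A × (Fin c → R)) →ₗ[R] B := i.coprod s
  have hh : ∀ x y, h (x, y) = i x + s y := fun x y => rfl
  have hr : ∀ x ∈ LinearMap.ker h, LinearMap.snd R A (Fin c → R) x ∈ LinearMap.ker g := by
    rintro ⟨x, y⟩ hx
    simp only [LinearMap.mem_ker, hh] at hx
    have := congrArg p hx
    simpa [hpi, hs'] using this
  let e : LinearMap.ker h ≃ₗ[R] LinearMap.ker g := by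
    refine LinearEquiv.ofBijective ((LinearMap.snd R _ _).restrict hr) ⟨?_, ?_⟩
    · rw [injective_iff_map_eq_zero]
      rintro ⟨⟨x, y⟩, hxy⟩ h0
      have h0 : y = 0 := congrArg Subtype.val h0
      subst h0
      simp only [LinearMap.mem_ker, hh, map_zero, add_zero] at hxy
      obtain rfl : x = 0 := hi (by rw [hxy, map_zero])
      rfl
    · rintro ⟨y, hy⟩
      rw [LinearMap.mem_ker] at hy
      obtain ⟨x, hx⟩ := (hip (s y)).1 (by rw [hs', hy])
      exact ⟨⟨(-x, y), by simp [hh, hx]⟩, rfl⟩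
  have hsurj : Function.Surjective h := by
    intro b
    obtain ⟨y, hy⟩ := hg (p b)
    obtain ⟨x, hx⟩ := (hip (b - s y)).1 (by rw [map_sub, hs', hy, sub_self])
    exact ⟨(x, y), by rw [hh, hx, sub_add_cancel]⟩
  have hP : IsFP R n (ModuleCat.of R (A × (Fin c → R))) :=
    IsFP.of_extension (i := (LinearMap.ker h).subtype) (p := h) (Submodule.injective_subtype _)
      (LinearMap.exact_subtype_ker_map h) hsurj (IsFP.of_linearEquiv e.symm hgk) hB
  cases n with
  | zero =>
    have : Module.Finite R (A × (Fin c → R)) := hP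
    exact Module.Finite.of_surjective (LinearMap.fst R A (Fin c → R)) LinearMap.fst_surjective
  | succ n =>
    exact IsFP.of_quotient (i := LinearMap.inr R A (Fin c → R))
      (p := LinearMap.fst R A (Fin c → R))
      LinearMap.inr_injective Function.Exact.inr_fst LinearMap.fst_surjective
      (IsFP.of_free n _) hP

end FP

section Ext

variable {R : Type u} [CommRing R]

theorem extZero_iff_exact {M : ModuleCat.{u} R} (P : ProjectiveResolution M)
    (N : ModuleCat.{u} R) (n : ℕ) :
    extZero R M N n ↔ ∀ f : P.complex.X n ⟶ N, P.complex.d (n + 1) n ≫ f = 0 →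
      ∃ g : P.complex.X ((ComplexShape.down ℕ).next n) ⟶ N, P.complex.d n _ ≫ g = f := by
  have h1 : extZero R M N n ↔ (P.complex.linearYonedaObj R N).ExactAt n := by
    rw [HomologicalComplex.exactAt_iff_isZero_homology, extZero,
      ← ModuleCat.isZero_iff_subsingleton]
    exact (P.isoExt n N).isZero_iff
  rw [h1, HomologicalComplex.exactAt_iff' _ _ n (n + 1) rfl (by simp),
    ShortComplex.moduleCat_exact_iff]
  rfl

theorem extZero_succ_iff_abelianExt (M N : ModuleCat.{u} R) (n : ℕ) :
    extZero R M N (n + 1) ↔ Subsingleton (Abelian.Ext M N (n + 1)) := by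
  let P := ProjectiveResolution.of M
  rw [extZero_iff_exact P]
  have hn : (ComplexShape.down ℕ).next (n + 1) = n := by simp
  rw [hn]
  constructor
  · refine fun h => subsingleton_of_forall_eq 0 fun α => ?_
    obtain ⟨f, hf, rfl⟩ := P.extMk_surjective α (n + 2) rfl
    exact (P.extMk_eq_zero_iff f _ rfl hf n rfl).2 (h f hf)
  · intro h f hf
    exact (P.extMk_eq_zero_iff f _ rfl hf n rfl).1 (Subsingleton.elim _ _)

theorem eq_zero_of_extZero_zero {M N : ModuleCat.{u} R} (h : extZero R M N 0) (f : M ⟶ N) :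
    f = 0 := by
  let P := ProjectiveResolution.of M
  rw [extZero_iff_exact P] at h
  obtain ⟨g, hg⟩ := h (P.π.f 0 ≫ (HomologicalComplex.singleObjXSelf _ 0 M).hom ≫ f)
    ((P.complex_d_comp_π_f_zero_assoc _).trans Limits.zero_comp)
  have hd : P.complex.d 0 ((ComplexShape.down ℕ).next 0) = 0 := P.complex.shape _ _ (by simp)
  rw [hd, Limits.zero_comp] at hg
  rw [← cancel_epi (HomologicalComplex.singleObjXSelf _ 0 M).hom, ← cancel_epi (P.π.f 0)]
  rw [Limits.comp_zero]
  exact hg.symm.trans Limits.comp_zero.symm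

variable {A B C : Type u} [AddCommGroup A] [Module R A] [AddCommGroup B] [Module R B]
  [AddCommGroup C] [Module R C] {i : A →ₗ[R] B} {p : B →ₗ[R] C}

theorem extZero_right {N : ModuleCat.{u} R} {n : ℕ} (hi : Function.Injective i)
    (hip : Function.Exact i p) (hp : Function.Surjective p)
    (hA : extZero R (ModuleCat.of R A) N (n + 1)) (hB : extZero R (ModuleCat.of R B) N (n + 2)) :
    extZero R (ModuleCat.of R C) N (n + 2) := by
  have hS := ModuleCat.shortComplex_shortExact
    (ModuleCat.shortComplexOfCompEqZero i p hip.linearMap_comp_eq_zero) hip hi hp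
  rw [extZero_succ_iff_abelianExt] at hA hB ⊢
  refine subsingleton_of_forall_eq 0 fun x => ?_
  obtain ⟨y, rfl⟩ := Abelian.Ext.contravariant_sequence_exact₃ hS N x
    (@Subsingleton.elim _ hB _ _) (show 1 + (n + 1) = _ by lia)
  rw [@Subsingleton.elim _ hA y 0, Abelian.Ext.comp_zero]

theorem extZero_left {N : ModuleCat.{u} R} {n : ℕ} (hi : Function.Injective i)
    (hip : Function.Exact i p) (hp : Function.Surjective p)
    (hB : extZero R (ModuleCat.of R B) N (n + 1)) (hC : extZero R (ModuleCat.of R C) N (n + 2)) :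
    extZero R (ModuleCat.of R A) N (n + 1) := by
  have hS := ModuleCat.shortComplex_shortExact
    (ModuleCat.shortComplexOfCompEqZero i p hip.linearMap_comp_eq_zero) hip hi hp
  rw [extZero_succ_iff_abelianExt] at hB hC ⊢
  refine subsingleton_of_forall_eq 0 fun x => ?_
  obtain ⟨y, rfl⟩ := Abelian.Ext.contravariant_sequence_exact₁ hS N x
    (show 1 + (n + 1) = n + 2 by lia) (@Subsingleton.elim _ hC _ _)
  rw [@Subsingleton.elim _ hB y 0, Abelian.Ext.comp_zero]

theorem dualMap_surjective_of_extZero_one (hi : Function.Injective i)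
    (hip : Function.Exact i p) (hp : Function.Surjective p)
    (hC : extZero R (ModuleCat.of R C) (ModuleCat.of R R) 1) :
    Function.Surjective i.dualMap := by
  intro φ
  have hS := ModuleCat.shortComplex_shortExact
    (ModuleCat.shortComplexOfCompEqZero i p hip.linearMap_comp_eq_zero) hip hi hp
  rw [extZero_succ_iff_abelianExt] at hC
  obtain ⟨y, hy⟩ := Abelian.Ext.contravariant_sequence_exact₁ hS (ModuleCat.of R R)
    (Abelian.Ext.mk₀ (ModuleCat.ofHom φ)) (show 1 + 0 = 1 by lia) (@Subsingleton.elim _ hC _ _)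
  obtain ⟨ψ, rfl⟩ := (Abelian.Ext.mk₀_bijective _ _).surjective y
  rw [Abelian.Ext.mk₀_comp_mk₀] at hy
  have := (Abelian.Ext.mk₀_bijective _ _).injective hy
  exact ⟨ψ.hom, congrArg ModuleCat.Hom.hom this⟩

theorem MemGtilde.of_quotient (hi : Function.Injective i)
    (hip : Function.Exact i p) (hp : Function.Surjective p)
    (hA : MemGtilde R (ModuleCat.of R A)) (hB : MemGtilde R (ModuleCat.of R B))
    (hC : extZero R (ModuleCat.of R C) (ModuleCat.of R R) 1) :
    MemGtilde R (ModuleCat.of R C) := by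
  obtain ⟨⟨_, hAr, hAe, hAde⟩, hAfp, hAdfp⟩ := hA
  obtain ⟨⟨hBf, hBr, hBe, hBde⟩, hBfp, hBdfp⟩ := hB
  change Module.Finite R B at hBf
  change Module.IsReflexive R A at hAr
  change Module.IsReflexive R B at hBr
  have hCf : Module.Finite R C := Module.Finite.of_surjective p hp
  have hpd : Function.Injective p.dualMap := LinearMap.dualMap_injective_of_surjective hp
  have hd : Function.Exact p.dualMap i.dualMap :=
    LinearMap.exact_lcomp_of_exact_of_surjective _ hip hp
  have hid := dualMap_surjective_of_extZero_one hi hip hp hC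
  have hdd : Function.Exact i.dualMap.dualMap p.dualMap.dualMap :=
    LinearMap.exact_lcomp_of_exact_of_surjective _ hd hid
  have hpdd := dualMap_surjective_of_extZero_one hpd hd hid (hAde 1 one_pos)
  refine ⟨⟨hCf, ⟨?_, ?_⟩, ?_, ?_⟩, ?_, ?_⟩
  · rw [injective_iff_map_eq_zero]
    intro c hc
    obtain ⟨b, rfl⟩ := hp c
    obtain ⟨α, hα⟩ := (hdd (Module.Dual.eval R B b)).1 hc
    obtain ⟨a, rfl⟩ := (Module.bijective_dual_eval R A).2 α
    obtain rfl : i a = b := (Module.bijective_dual_eval R B).1 hα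
    exact hip.apply_apply_eq_zero a
  · intro γ
    obtain ⟨β, rfl⟩ := hpdd γ
    obtain ⟨b, rfl⟩ := (Module.bijective_dual_eval R B).2 β
    exact ⟨p b, rfl⟩
  · rintro (_ | _ | n) hn
    · exact absurd hn (lt_irrefl 0)
    · exact hC
    · exact extZero_right hi hip hp (hAe _ n.succ_pos) (hBe _ hn)
  · rintro (_ | n) hn
    · exact absurd hn (lt_irrefl 0)
    · exact extZero_left hpd hd hid (hBde _ hn) (hAde _ (Nat.succ_pos _))
  · rintro (_ | n)
    · exact hCf
    · exact IsFP.of_quotient hi hip hp (hAfp n) (hBfp _)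
  · exact fun n => IsFP.of_kernel hpd hd hid (hBdfp n) (hAdfp _)

theorem GtildeDimLe.extZero_of_lt {n : ℕ} {M : ModuleCat.{u} R} (h : GtildeDimLe R n M) {j : ℕ}
    (hj : n < j) : extZero R M (ModuleCat.of R R) j := by
  induction n generalizing M j with
  | zero => exact h.1.2.2.1 j hj
  | succ n ih =>
    obtain ⟨G, f, hG, hf, hk⟩ := h
    obtain ⟨j, rfl⟩ : ∃ m, j = m + 2 := ⟨j - 2, by lia⟩
    exact extZero_right (Submodule.injective_subtype _) (LinearMap.exact_subtype_ker_map f) hf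
      (ih hk (by lia)) (hG.1.2.2.1 _ (by lia))

theorem GtildeDimLe.of_extZero {n : ℕ} {M : ModuleCat.{u} R} (h : GtildeDimLe R (n + 1) M)
    (he : extZero R M (ModuleCat.of R R) (n + 1)) : GtildeDimLe R n M := by
  induction n generalizing M with
  | zero =>
    obtain ⟨G, f, hG, hf, hk⟩ := h
    exact MemGtilde.of_quotient (Submodule.injective_subtype _)
      (LinearMap.exact_subtype_ker_map f) hf hk hG he
  | succ n ih =>
    obtain ⟨G, f, hG, hf, hk⟩ := h
    exact ⟨G, f, hG, hf, ih hk (extZero_left (Submodule.injective_subtype _)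
      (LinearMap.exact_subtype_ker_map f) hf (hG.1.2.2.1 _ n.succ_pos) he)⟩

theorem MemG.not_extZero_zero {M : ModuleCat.{u} R} [Nontrivial M] (h : MemG R M) :
    ¬ extZero R M (ModuleCat.of R R) 0 := by
  intro h0
  obtain ⟨-, hr, -⟩ := h
  obtain ⟨x, hx⟩ := exists_ne (0 : M)
  refine hx ((Module.bijective_dual_eval R M).1 (LinearMap.ext fun φ => ?_))
  have := congrArg ModuleCat.Hom.hom (eq_zero_of_extZero_zero h0 (ModuleCat.ofHom φ))
  have hφ : φ = 0 := this
  simp [hφ]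

end Ext

end AB

theorem gtildeDim_eq_sup_ext (R : Type u) [CommRing R] (M : ModuleCat.{u} R)
    (hM0 : Nontrivial M) (hfp : AB.IsFPInf R M) (hfin : AB.GtildeDim R M ≠ ⊤) :
    AB.GtildeDim R M =
      sSup {i : ℕ∞ | ∃ j : ℕ, i = j ∧ ¬ AB.extZero R M (ModuleCat.of R R) j} := by
  have hne : {n : ℕ∞ | ∃ m : ℕ, n = m ∧ AB.GtildeDimLe R m M}.Nonempty := by
    rw [Set.nonempty_iff_ne_empty]
    intro h
    exact hfin (by rw [AB.GtildeDim, h, sInf_empty])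
  obtain ⟨n, hn, hle⟩ := csInf_mem hne
  change AB.GtildeDim R M = n at hn
  apply le_antisymm
  · rw [hn]
    refine le_sSup ⟨n, rfl, fun h0 => ?_⟩
    cases n with
    | zero => exact hle.1.not_extZero_zero h0
    | succ n =>
      have : AB.GtildeDim R M ≤ n := sInf_le ⟨n, rfl, hle.of_extZero h0⟩
      rw [hn, Nat.cast_le] at this
      lia
  · refine sSup_le ?_
    rintro _ ⟨j, rfl, hj⟩
    rw [hn, Nat.cast_le]
    by_contra! hlt
    exact hj (hle.extZero_of_lt hlt)
end

section
/- Let R be a coherent ring and M a finitely presented R-module. Then the G-dimension of M equals the restricted G-dimension of M. -/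
open CategoryTheory Opposite TensorProduct

universe u

universe w

namespace CategoryTheory

/-- In positive degrees, the vanishing of `Ext` defined through derived functors agrees with the
vanishing of `Abelian.Ext`. -/
lemma subsingleton_Ext_obj_iff {R : Type*} [Ring R] {C : Type*} [Category* C] [Abelian C]
    [Linear R C] [EnoughProjectives C] [HasExt.{w} C] (X Y : C) (n : ℕ) :
    Subsingleton (((Ext R C (n + 1)).obj (op X)).obj Y) ↔
      Subsingleton (Abelian.Ext X Y (n + 1)) := by
  let P := projectiveResolution X
  have key : Subsingleton (((Ext R C (n + 1)).obj (op X)).obj Y) ↔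
      ∀ f : P.complex.X (n + 1) ⟶ Y, P.complex.d (n + 2) (n + 1) ≫ f = 0 →
        ∃ g : P.complex.X n ⟶ Y, P.complex.d (n + 1) n ≫ g = f := by
    rw [← ModuleCat.isZero_iff_subsingleton, (P.isoExt (R := R) (n + 1) Y).isZero_iff,
      ← HomologicalComplex.exactAt_iff_isZero_homology,
      HomologicalComplex.exactAt_iff' _ n (n + 1) (n + 2) (by simp) (by simp),
      ShortComplex.moduleCat_exact_iff]
    rfl
  rw [key]
  constructor
  · intro h
    refine subsingleton_of_forall_eq 0 fun α ↦ ?_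
    obtain ⟨f, hf, rfl⟩ := P.extMk_surjective α (n + 2) rfl
    rw [P.extMk_eq_zero_iff f (n + 2) rfl hf n rfl]
    exact h f hf
  · intro h f hf
    rw [← P.extMk_eq_zero_iff f (n + 2) rfl hf n rfl]
    exact Subsingleton.elim _ _

end CategoryTheory

namespace Module

section Coherent

variable {R : Type*} [CommRing R]

lemma finitePresentation_of_injective_pi
    (hcoh : ∀ I : Ideal R, I.FG → Module.FinitePresentation R I) (k : ℕ) :
    ∀ (N : Type*) [AddCommGroup N] [Module R N] [Module.Finite R N] (i : N →ₗ[R] (Fin k → R)),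
      Function.Injective i → Module.FinitePresentation R N := by
  induction k with
  | zero =>
    intro N _ _ _ i hi
    have := hi.subsingleton
    infer_instance
  | succ k ih =>
    intro N _ _ _ i hi
    let p : N →ₗ[R] R := LinearMap.proj 0 ∘ₗ i
    have : Module.FinitePresentation R (LinearMap.range p) :=
      hcoh (LinearMap.range p) (Submodule.fg_range p)
    have : Module.Finite R (LinearMap.ker p.rangeRestrict) :=
      Module.Finite.iff_fg.mpr
        (Module.FinitePresentation.fg_ker _ (LinearMap.surjective_rangeRestrict p))
    have : Module.FinitePresentation R (LinearMap.ker p.rangeRestrict) := by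
      refine ih _ (LinearMap.funLeft R R Fin.succ ∘ₗ i ∘ₗ Submodule.subtype _) ?_
      rw [injective_iff_map_eq_zero]
      rintro ⟨x, hx⟩ h
      have hx0 : i x 0 = 0 := by simpa [p, Subtype.ext_iff] using hx
      refine Subtype.ext ((injective_iff_map_eq_zero i).mp hi x (funext fun j ↦ ?_))
      refine Fin.cases hx0 (fun j ↦ ?_) j
      exact congr_fun h j
    exact Module.finitePresentation_of_ker p.rangeRestrict (LinearMap.surjective_rangeRestrict p)

lemma finitePresentation_dual
    (hcoh : ∀ I : Ideal R, I.FG → Module.FinitePresentation R I)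
    (M : Type*) [AddCommGroup M] [Module R M] [Module.FinitePresentation R M] :
    Module.FinitePresentation R (Module.Dual R M) := by
  obtain ⟨k, f, hf⟩ := Module.Finite.exists_fin' R M
  have : Module.Finite R (LinearMap.ker f) :=
    Module.Finite.iff_fg.mpr (Module.FinitePresentation.fg_ker f hf)
  obtain ⟨l, g, hg⟩ := Module.Finite.exists_fin' R (LinearMap.ker f)
  let e := (Pi.basisFun R (Fin l)).dualBasis.equivFun
  let d : Module.Dual R (Fin k → R) →ₗ[R] (Fin l → R) :=
    e.toLinearMap ∘ₗ (Submodule.subtype _ ∘ₗ g).dualMap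
  have : Module.FinitePresentation R (LinearMap.range d) :=
    finitePresentation_of_injective_pi hcoh l _ (Submodule.subtype _)
      (Submodule.subtype_injective _)
  have hker : LinearMap.ker d.rangeRestrict = LinearMap.range f.dualMap := by
    rw [LinearMap.ker_rangeRestrict, LinearEquiv.ker_comp]
    ext φ
    constructor
    · intro h
      have hφ : LinearMap.ker f ≤ LinearMap.ker φ := fun x hx ↦ by
        obtain ⟨y, hy⟩ := hg ⟨x, hx⟩
        simpa [hy] using LinearMap.congr_fun h y
      rw [LinearMap.range_dualMap_eq_dualAnnihilator_ker_of_surjective f hf]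
      exact (Submodule.mem_dualAnnihilator φ).mpr fun x hx ↦ hφ hx
    · rintro ⟨ψ, rfl⟩
      ext y
      simp
  have hfg : (LinearMap.range f.dualMap).FG := by
    rw [← hker]
    exact Module.FinitePresentation.fg_ker d.rangeRestrict (LinearMap.surjective_rangeRestrict d)
  have hinj := LinearMap.dualMap_injective_of_surjective hf
  have : Module.Finite R (LinearMap.range f.dualMap) := Module.Finite.iff_fg.mpr hfg
  have : Module.Finite R (Module.Dual R M) :=
    Module.Finite.equiv (LinearEquiv.ofInjective _ hinj).symm
  exact finitePresentation_of_injective_pi hcoh k _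
    ((Pi.basisFun R (Fin k)).dualBasis.equivFun.toLinearMap ∘ₗ f.dualMap)
    ((Pi.basisFun R (Fin k)).dualBasis.equivFun.injective.comp hinj)

end Coherent

end Module

namespace AB

section

variable {R : Type u} [CommRing R]

lemma isFPInf_of_finitePresentation
    (hcoh : ∀ I : Ideal R, I.FG → Module.FinitePresentation R I)
    (M : ModuleCat.{u} R) [Module.FinitePresentation R M] : IsFPInf R M := by
  intro n
  induction n generalizing M with
  | zero => exact inferInstanceAs (Module.Finite R M)
  | succ n ih =>
    obtain ⟨k, f, hf⟩ := Module.Finite.exists_fin' R M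
    have : Module.Finite R (LinearMap.ker f) :=
      Module.Finite.iff_fg.mpr (Module.FinitePresentation.fg_ker f hf)
    have : Module.FinitePresentation R (LinearMap.ker f) :=
      Module.finitePresentation_of_injective_pi hcoh k _ (Submodule.subtype _)
        (Submodule.subtype_injective _)
    exact ⟨k, f, hf, ih (ModuleCat.of R (LinearMap.ker f))⟩

variable (R) in
/-- The module `M` satisfies `Ext^i_R(M, R) = 0` for all `i > 0`. -/
def DualAcyclic (M : Type u) [AddCommGroup M] [Module R M] : Prop :=
  ∀ i : ℕ, Subsingleton (Abelian.Ext (ModuleCat.of R M) (ModuleCat.of R R) (i + 1))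

lemma dualAcyclic_iff_extZero (M : Type u) [AddCommGroup M] [Module R M] :
    DualAcyclic R M ↔ ∀ i > 0, extZero R (ModuleCat.of R M) (ModuleCat.of R R) i := by
  constructor
  · rintro h (_ | i) hi
    · exact absurd hi (lt_irrefl 0)
    · exact (subsingleton_Ext_obj_iff _ _ i).mpr (h i)
  · exact fun h i ↦ (subsingleton_Ext_obj_iff (R := R) _ _ i).mp (h (i + 1) i.succ_pos)

lemma dualAcyclic_of_projective (M : Type u) [AddCommGroup M] [Module R M]
    [Module.Projective R M] : DualAcyclic R M := fun i ↦
  have := (IsProjective.iff_projective (R := R) M).mp inferInstance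
  Abelian.Ext.subsingleton_of_projective _ _ i

section Exact

variable {A B C : Type u} [AddCommGroup A] [Module R A] [AddCommGroup B] [Module R B]
  [AddCommGroup C] [Module R C] {f : A →ₗ[R] B} {g : B →ₗ[R] C}

open Abelian.Ext

lemma exists_shortExact (hf : Function.Injective f) (hfg : Function.Exact f g)
    (hg : Function.Surjective g) :
    ∃ w, (ShortComplex.mk (ModuleCat.ofHom f) (ModuleCat.ofHom g) w).ShortExact :=
  ⟨by ext x; exact hfg.apply_apply_eq_zero x,
    ModuleCat.shortComplex_shortExact _ hfg hf hg⟩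

lemma DualAcyclic.middle (hf : Function.Injective f) (hfg : Function.Exact f g)
    (hg : Function.Surjective g) (hA : DualAcyclic R A) (hC : DualAcyclic R C) :
    DualAcyclic R B := by
  obtain ⟨w, hS⟩ := exists_shortExact hf hfg hg
  refine fun i ↦ subsingleton_of_forall_eq 0 fun x ↦ ?_
  have := hA i
  have := hC i
  obtain ⟨y, rfl⟩ := contravariant_sequence_exact₂ hS _ x (Subsingleton.elim (α :=
    Abelian.Ext (ModuleCat.of R A) (ModuleCat.of R R) (i + 1)) _ _)
  rw [Subsingleton.elim (α := Abelian.Ext (ModuleCat.of R C) (ModuleCat.of R R) (i + 1)) y 0,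
    comp_zero]

lemma DualAcyclic.left (hf : Function.Injective f) (hfg : Function.Exact f g)
    (hg : Function.Surjective g) (hB : DualAcyclic R B) (hC : DualAcyclic R C) :
    DualAcyclic R A := by
  obtain ⟨w, hS⟩ := exists_shortExact hf hfg hg
  refine fun i ↦ subsingleton_of_forall_eq 0 fun x ↦ ?_
  have := hB i
  have := hC (i + 1)
  obtain ⟨y, rfl⟩ := contravariant_sequence_exact₁ hS _ x (add_comm 1 (i + 1))
    (Subsingleton.elim (α := Abelian.Ext (ModuleCat.of R C) (ModuleCat.of R R) (i + 1 + 1)) _ _)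
  rw [Subsingleton.elim (α := Abelian.Ext (ModuleCat.of R B) (ModuleCat.of R R) (i + 1)) y 0,
    comp_zero]

lemma DualAcyclic.dualMap_surjective (hf : Function.Injective f) (hfg : Function.Exact f g)
    (hg : Function.Surjective g) (hC : DualAcyclic R C) : Function.Surjective f.dualMap := by
  obtain ⟨w, hS⟩ := exists_shortExact hf hfg hg
  intro φ
  have := hC 0
  obtain ⟨y, hy⟩ := contravariant_sequence_exact₁ hS _ (mk₀ (ModuleCat.ofHom φ)) rfl
    (Subsingleton.elim (α := Abelian.Ext (ModuleCat.of R C) (ModuleCat.of R R) (0 + 1)) _ _)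
  obtain ⟨ψ, rfl⟩ := (mk₀_bijective _ _).2 y
  rw [mk₀_comp_mk₀] at hy
  exact ⟨ψ.hom, congr_arg ModuleCat.Hom.hom ((mk₀_bijective _ _).1 hy)⟩

lemma DualAcyclic.right (hf : Function.Injective f) (hfg : Function.Exact f g)
    (hg : Function.Surjective g) (hA : DualAcyclic R A) (hB : DualAcyclic R B)
    (hdual : Function.Surjective f.dualMap) : DualAcyclic R C := by
  obtain ⟨w, hS⟩ := exists_shortExact hf hfg hg
  refine fun i ↦ subsingleton_of_forall_eq 0 fun x ↦ ?_
  have := hB i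
  obtain ⟨y, rfl⟩ := contravariant_sequence_exact₃ hS _ x (Subsingleton.elim (α :=
    Abelian.Ext (ModuleCat.of R B) (ModuleCat.of R R) (i + 1)) _ _) (add_comm 1 i)
  obtain ⟨z, rfl⟩ : ∃ z, (mk₀ (ModuleCat.ofHom f)).comp z (zero_add i) = y := by
    cases i with
    | zero =>
      obtain ⟨φ, rfl⟩ := (mk₀_bijective _ _).2 y
      obtain ⟨ψ, hψ⟩ := hdual φ.hom
      refine ⟨mk₀ (ModuleCat.ofHom ψ), ?_⟩
      rw [mk₀_comp_mk₀]
      exact congr_arg mk₀ (ModuleCat.hom_ext hψ)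
    | succ i =>
      have := hA i
      exact ⟨0, Subsingleton.elim (α := Abelian.Ext (ModuleCat.of R A) (ModuleCat.of R R) (i + 1))
        _ _⟩
  exact hS.extClass_comp_assoc z

end Exact

variable (R) in
/-- The conditions defining the G-class, without finite generation. -/
structure MemWeakG (M : Type u) [AddCommGroup M] [Module R M] : Prop where
  isReflexive : Module.IsReflexive R M
  dualAcyclic : DualAcyclic R M
  dualAcyclic_dual : DualAcyclic R (Module.Dual R M)

lemma memG_iff (M : ModuleCat.{u} R) : MemG R M ↔ Module.Finite R M ∧ MemWeakG R M := by
  have h₁ := dualAcyclic_iff_extZero (R := R) M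
  have h₂ := dualAcyclic_iff_extZero (R := R) (Module.Dual R M)
  constructor
  · rintro ⟨hfin, hrefl, h, h'⟩
    exact ⟨hfin, hrefl, h₁.mpr h, h₂.mpr h'⟩
  · rintro ⟨hfin, hrefl, h, h'⟩
    exact ⟨hfin, hrefl, h₁.mp h, h₂.mp h'⟩

namespace MemWeakG

lemma of_free (F : Type u) [AddCommGroup F] [Module R F] [Module.Free R F]
    [Module.Finite R F] : MemWeakG R F where
  isReflexive := inferInstance
  dualAcyclic := dualAcyclic_of_projective F
  dualAcyclic_dual := dualAcyclic_of_projective _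

variable {A B C : Type u} [AddCommGroup A] [Module R A] [AddCommGroup B] [Module R B]
  [AddCommGroup C] [Module R C] {f : A →ₗ[R] B} {g : B →ₗ[R] C}

lemma prod (hA : MemWeakG R A) (hB : MemWeakG R B) : MemWeakG R (A × B) where
  isReflexive :=
    have := hA.isReflexive
    have := hB.isReflexive
    inferInstance
  dualAcyclic := .middle (LinearMap.inl_injective (R := R)) Function.Exact.inl_snd
    LinearMap.snd_surjective hA.dualAcyclic hB.dualAcyclic
  dualAcyclic_dual := by
    refine .middle (f := (LinearMap.fst R A B).dualMap) (g := (LinearMap.inr R A B).dualMap)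
      (LinearMap.dualMap_injective_of_surjective LinearMap.fst_surjective) ?_ ?_
      hA.dualAcyclic_dual hB.dualAcyclic_dual
    · intro φ
      refine ⟨fun h ↦ ⟨φ ∘ₗ LinearMap.inl R A B, ?_⟩, ?_⟩
      · ext x
        · simp
        · have hx : φ (0, x) = 0 := LinearMap.congr_fun h x
          have h0 : φ (0, 0) = 0 := map_zero φ
          simp [hx, h0]
      · rintro ⟨ψ, rfl⟩
        ext x
        simp
    · exact fun φ ↦ ⟨φ ∘ₗ LinearMap.snd R A B, by ext x; simp⟩

/-- The weak G-class is closed under kernels of epimorphisms. -/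
lemma left (hf : Function.Injective f) (hfg : Function.Exact f g) (hg : Function.Surjective g)
    (hB : MemWeakG R B) (hC : MemWeakG R C) : MemWeakG R A := by
  have := hB.isReflexive
  have := hC.isReflexive
  have hdual := hC.dualAcyclic.dualMap_surjective hf hfg hg
  refine ⟨⟨?_, ?_⟩, hB.dualAcyclic.left hf hfg hg hC.dualAcyclic, ?_⟩
  · rw [injective_iff_map_eq_zero]
    intro x hx
    refine (injective_iff_map_eq_zero f).mp hf x
      ((injective_iff_map_eq_zero _).mp (Module.bijective_dual_eval R B).1 _ ?_)
    ext φ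
    exact LinearMap.congr_fun hx (f.dualMap φ)
  · intro ψ
    obtain ⟨b, hb⟩ := (Module.bijective_dual_eval R B).2 (f.dualMap.dualMap ψ)
    have hb' (φ : Module.Dual R B) : φ b = ψ (f.dualMap φ) := LinearMap.congr_fun hb φ
    have hgb : g b = 0 := by
      refine (injective_iff_map_eq_zero _).mp (Module.bijective_dual_eval R C).1 _ ?_
      ext θ
      have hθ : f.dualMap (g.dualMap θ) = 0 := by
        ext x
        simp [hfg.apply_apply_eq_zero]
      simpa [hθ] using hb' (g.dualMap θ)
    obtain ⟨a, rfl⟩ := (hfg b).mp hgb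
    refine ⟨a, LinearMap.ext fun φ ↦ ?_⟩
    obtain ⟨θ, rfl⟩ := hdual φ
    exact hb' θ
  · refine .right (f := g.dualMap) (g := f.dualMap)
      (LinearMap.dualMap_injective_of_surjective hg) ?_ hdual
      hC.dualAcyclic_dual hB.dualAcyclic_dual ?_
    · intro φ
      constructor
      · intro h
        have hker : LinearMap.ker g ≤ LinearMap.ker φ := fun x hx ↦ by
          obtain ⟨a, rfl⟩ := (hfg x).mp hx
          exact LinearMap.congr_fun h a
        change φ ∈ LinearMap.range g.dualMap
        rw [LinearMap.range_dualMap_eq_dualAnnihilator_ker_of_surjective g hg]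
        exact (Submodule.mem_dualAnnihilator φ).mpr fun x hx ↦ hker hx
      · rintro ⟨θ, rfl⟩
        ext x
        simp [hfg.apply_apply_eq_zero]
    · intro ψ
      obtain ⟨c, rfl⟩ := (Module.bijective_dual_eval R C).2 ψ
      obtain ⟨b, rfl⟩ := hg c
      exact ⟨Module.Dual.eval R B b, rfl⟩

end MemWeakG

variable (R) in
/-- `M` has a resolution of length `n` by modules in the weak G-class. -/
def WeakGDimLe : ℕ → ModuleCat.{u} R → Prop
  | 0, M => MemWeakG R M
  | n + 1, M => ∃ (G K : ModuleCat.{u} R) (i : K →ₗ[R] G) (f : G →ₗ[R] M), MemWeakG R G ∧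
      Function.Injective i ∧ Function.Exact i f ∧ Function.Surjective f ∧ WeakGDimLe n K

lemma GDimLe.weakGDimLe {n : ℕ} {M : ModuleCat.{u} R} (h : GDimLe R n M) :
    WeakGDimLe R n M := by
  induction n generalizing M with
  | zero => exact ((memG_iff M).mp h).2
  | succ n ih =>
    obtain ⟨G, f, hG, hf, hK⟩ := h
    exact ⟨G, ModuleCat.of R (LinearMap.ker f), Submodule.subtype _, f, ((memG_iff G).mp hG).2,
      Submodule.subtype_injective _, LinearMap.exact_subtype_ker_map f, hf, ih hK⟩

lemma GtildeDimLe.gDimLe {n : ℕ} {M : ModuleCat.{u} R} (h : GtildeDimLe R n M) :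
    GDimLe R n M := by
  induction n generalizing M with
  | zero => exact h.1
  | succ n ih =>
    obtain ⟨G, f, hG, hf, hK⟩ := h
    exact ⟨G, f, hG.1, hf, ih hK⟩

namespace WeakGDimLe

lemma prod {n : ℕ} {M F : ModuleCat.{u} R} (h : WeakGDimLe R n M) (hF : MemWeakG R F) :
    WeakGDimLe R n (ModuleCat.of R (M × F)) := by
  cases n with
  | zero => exact MemWeakG.prod h hF
  | succ n =>
    obtain ⟨G, K, i, f, hG, hi, hif, hf, hK⟩ := h
    refine ⟨ModuleCat.of R (G × F), K, LinearMap.inl R G F ∘ₗ i, f.prodMap LinearMap.id,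
      hG.prod hF, LinearMap.inl_injective.comp hi, ?_, hf.prodMap Function.surjective_id, hK⟩
    rintro ⟨x, y⟩
    have := hif x
    simp_all [Prod.ext_iff, eq_comm]

/-- The kernel of an epimorphism onto a module in the weak G-class has no larger dimension. -/
lemma left {n : ℕ} {A B C : ModuleCat.{u} R} {f : A →ₗ[R] B} {g : B →ₗ[R] C}
    (hf : Function.Injective f) (hfg : Function.Exact f g) (hg : Function.Surjective g)
    (hB : WeakGDimLe R n B) (hC : MemWeakG R C) : WeakGDimLe R n A := by
  cases n with
  | zero => exact MemWeakG.left hf hfg hg hB hC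
  | succ n =>
    obtain ⟨G, K, i, p, hG, hi, hip, hp, hK⟩ := hB
    let H : Submodule R G := LinearMap.ker (g ∘ₗ p)
    have hH : MemWeakG R H := .left (Submodule.subtype_injective _)
      (LinearMap.exact_subtype_ker_map (g ∘ₗ p)) (hg.comp hp) hG hC
    have hpH (x : H) : p x ∈ LinearMap.range f := (hfg _).mp x.2
    let e := LinearEquiv.ofInjective f hf
    let q : H →ₗ[R] A := e.symm.toLinearMap ∘ₗ (p ∘ₗ H.subtype).codRestrict _ hpH
    have hq (x : H) : f (q x) = p x := congr_arg Subtype.val (e.apply_symm_apply ⟨p x, hpH x⟩)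
    have hiH (x : K) : i x ∈ H := by simp [H, hip.apply_apply_eq_zero]
    refine ⟨ModuleCat.of R H, K, i.codRestrict H hiH, q, hH,
      fun x y hxy ↦ hi (congr_arg Subtype.val hxy), fun x ↦ ?_, fun a ↦ ?_, hK⟩
    · rw [← map_eq_zero_iff f hf, hq, hip]
      simp [Subtype.ext_iff]
    · obtain ⟨x, hx⟩ := hp (f a)
      exact ⟨⟨x, by simp [H, hx, hfg.apply_apply_eq_zero]⟩, hf ((hq _).trans hx)⟩

/-- The first syzygy with respect to a finitely generated free cover. -/
lemma syzygy {n : ℕ} {M F K : ModuleCat.{u} R} [Module.Free R F] [Module.Finite R F]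
    {i : K →ₗ[R] F} {p : F →ₗ[R] M}
    (hi : Function.Injective i) (hip : Function.Exact i p) (hp : Function.Surjective p)
    (h : WeakGDimLe R (n + 1) M) : WeakGDimLe R n K := by
  obtain ⟨G, L, j, f, hG, hj, hjf, hf, hL⟩ := h
  obtain ⟨s, hs⟩ := Module.projective_lifting_property f p hf
  have hs' (x : F) : f (s x) = p x := LinearMap.congr_fun hs x
  have hsK (x : K) : s (i x) ∈ LinearMap.range j :=
    (hjf _).mp (by rw [hs', hip.apply_apply_eq_zero])
  let e := LinearEquiv.ofInjective j hj
  let t : K →ₗ[R] L := e.symm.toLinearMap ∘ₗ (s ∘ₗ i).codRestrict _ hsK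
  have ht (x : K) : j (t x) = s (i x) :=
    congr_arg Subtype.val (e.apply_symm_apply ⟨s (i x), hsK x⟩)
  refine (hL.prod (MemWeakG.of_free F)).left (f := (-t).prod i) (g := j.coprod s) (C := G)
    (fun x y hxy ↦ hi (congr_arg Prod.snd hxy)) ?_ ?_ hG
  · rintro ⟨l, x⟩
    constructor
    · intro h
      have h' : j l + s x = 0 := by simpa using h
      have hx : p x = 0 := by
        rw [← hs', eq_neg_of_add_eq_zero_right h', map_neg, hjf.apply_apply_eq_zero, neg_zero]
      obtain ⟨k, rfl⟩ := (hip x).mp hx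
      refine ⟨k, Prod.ext (hj ?_) rfl⟩
      simpa [ht] using (eq_neg_of_add_eq_zero_left h').symm
    · rintro ⟨k, hk⟩
      rw [← hk]
      simp [ht]
  · intro y
    obtain ⟨x, hx⟩ := hp (f y)
    obtain ⟨l, hl⟩ := (hjf (y - s x)).mp (by rw [map_sub, hs', hx, sub_self])
    exact ⟨(l, x), by simp [hl]⟩

lemma gtildeDimLe (hcoh : ∀ I : Ideal R, I.FG → Module.FinitePresentation R I) {n : ℕ}
    {M : ModuleCat.{u} R} [Module.FinitePresentation R M] (h : WeakGDimLe R n M) :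
    GtildeDimLe R n M := by
  have memGtilde (N : ModuleCat.{u} R) [Module.FinitePresentation R N] (hN : MemWeakG R N) :
      MemGtilde R N :=
    have := Module.finitePresentation_dual hcoh N
    ⟨(memG_iff N).mpr ⟨inferInstance, hN⟩, isFPInf_of_finitePresentation hcoh N,
      isFPInf_of_finitePresentation hcoh (ModuleCat.of R (Module.Dual R N))⟩
  induction n generalizing M with
  | zero => exact memGtilde M h
  | succ n ih =>
    obtain ⟨k, f, hf⟩ := Module.Finite.exists_fin' R M
    have : Module.Finite R (LinearMap.ker f) :=
      Module.Finite.iff_fg.mpr (Module.FinitePresentation.fg_ker f hf)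
    have : Module.FinitePresentation R (LinearMap.ker f) :=
      Module.finitePresentation_of_injective_pi hcoh k _ (Submodule.subtype _)
        (Submodule.subtype_injective _)
    refine ⟨ModuleCat.of R (Fin k → R), f, memGtilde _ (.of_free _), hf, ?_⟩
    exact ih (M := ModuleCat.of R (LinearMap.ker f))
      (h.syzygy (F := ModuleCat.of R (Fin k → R)) (i := Submodule.subtype _) (p := f)
        (Submodule.subtype_injective _) (LinearMap.exact_subtype_ker_map f) hf)

end WeakGDimLe

end

end AB

theorem gDim_eq_gtildeDim_of_coherent (R : Type u) [CommRing R]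
    (hcoh : ∀ I : Ideal R, I.FG → Module.FinitePresentation R I)
    (M : Type u) [AddCommGroup M] [Module R M] [Module.FinitePresentation R M] :
    AB.GDim R (ModuleCat.of R M) = AB.GtildeDim R (ModuleCat.of R M) := by
  have key (m : ℕ) :
      AB.GDimLe R m (ModuleCat.of R M) ↔ AB.GtildeDimLe R m (ModuleCat.of R M) :=
    ⟨fun h ↦ h.weakGDimLe.gtildeDimLe hcoh, fun h ↦ h.gDimLe⟩
  simp only [AB.GDim, AB.GtildeDim, key]
end
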